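/- Let T be a stable tree of the tree connection game and let x be any node of T with two distinct children u and v (i.e., the activated edges (u, x) and (v, x) belong to T). Then indeg(x) ≤ indeg(v) · (1 + |T(u)|/|T(v)|) + 1. -/

import Mathlib

open Function
open scoped ENNReal Classical

noncomputable section

namespace TCG

variable {n : ℕ}

/-- In-degree of node `v` in the network induced by profile `s` with root `r`:
the number of activated edges `(u, v)` with `u` an agent (a non-root node). -/
def indeg (r : Fin (n + 1)) (s : Fin (n + 1) → Fin (n + 1)) (v : Fin (n + 1)) : ℕ :=
  Nat.card {u : Fin (n + 1) | u ≠ r ∧ s u = v}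

/-- `|T(u)|`: the number of nodes having a directed path to `u` (including `u` itself). -/
def subtreeSize (s : Fin (n + 1) → Fin (n + 1)) (u : Fin (n + 1)) : ℕ :=
  Nat.card {w : Fin (n + 1) | ∃ k, s^[k] w = u}

/-- Cost of the agent at node `v` with respect to the root `r`:
the sum, over the edges `(u, u')` of the unique directed path from `v` to `r`,
of `indeg(u') / |T(u)|`; the cost is `∞` if no such path exists. -/
def cost (r : Fin (n + 1)) (s : Fin (n + 1) → Fin (n + 1)) (v : Fin (n + 1)) : ℝ≥0∞ :=
  if h : ∃ k, s^[k] v = r then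
    ∑ k ∈ Finset.range (Nat.find h),
      (indeg r s (s^[k + 1] v) : ℝ≥0∞) / (subtreeSize s (s^[k] v) : ℝ≥0∞)
  else ⊤

/-- A valid strategy profile: the root is absorbing (a formal convention encoding that the
root activates no edge), and every agent chooses a node different from herself. -/
def ValidProfile (r : Fin (n + 1)) (s : Fin (n + 1) → Fin (n + 1)) : Prop :=
  s r = r ∧ ∀ v, v ≠ r → s v ≠ v

/-- Pure Nash equilibrium (the induced network is *stable*): no agent can strictly
decrease her cost by unilaterally switching her activated edge to another node. -/
def IsStable (r : Fin (n + 1)) (s : Fin (n + 1) → Fin (n + 1)) : Prop :=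
  ValidProfile r s ∧
    ∀ v, v ≠ r → ∀ w, w ≠ v → cost r s v ≤ cost r (Function.update s v w) v

/-- Social cost: the sum of the costs of all agents (the non-root nodes). -/
def SC (s : Fin (n + 1) → Fin (n + 1)) : ℝ≥0∞ :=
  ∑ v ∈ Finset.univ.erase (0 : Fin (n + 1)), cost 0 s v

/-- Height of the induced network: the maximum length of a (leaf-to-)root path,
i.e. the least `k` such that every node arrives at the root after `k` steps. -/
def height (s : Fin (n + 1) → Fin (n + 1)) : ℕ :=
  sInf {k | ∀ v, s^[k] v = 0}

/-- Fairness Ratio: maximum agent cost divided by minimum agent cost. -/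
def FR (s : Fin (n + 1) → Fin (n + 1)) : ℝ≥0∞ :=
  (⨆ (v : Fin (n + 1)) (_ : v ≠ 0), cost 0 s v) /
    (⨅ (v : Fin (n + 1)) (_ : v ≠ 0), cost 0 s v)

/-- `Reaches s w y`: following the activated edges of `s`, node `w` arrives at `y`. -/
def Reaches (s : Fin (n + 1) → Fin (n + 1)) (w y : Fin (n + 1)) : Prop :=
  ∃ k, s^[k] w = y

theorem Reaches.refl (s : Fin (n + 1) → Fin (n + 1)) (w : Fin (n + 1)) : Reaches s w w :=
  ⟨0, rfl⟩

theorem Reaches.head {s : Fin (n + 1) → Fin (n + 1)} {w y : Fin (n + 1)}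
    (h : Reaches s (s w) y) : Reaches s w y := by
  obtain ⟨k, hk⟩ := h
  exact ⟨k + 1, by rwa [iterate_succ_apply]⟩

theorem Reaches.tail {s : Fin (n + 1) → Fin (n + 1)} {w y : Fin (n + 1)}
    (h : Reaches s w y) : Reaches s w (s y) := by
  obtain ⟨k, rfl⟩ := h
  exact ⟨k + 1, by rw [iterate_succ_apply']⟩

theorem Reaches.trans {s : Fin (n + 1) → Fin (n + 1)} {w y z : Fin (n + 1)}
    (h₁ : Reaches s w y) (h₂ : Reaches s y z) : Reaches s w z := by
  obtain ⟨k, rfl⟩ := h₁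
  obtain ⟨l, rfl⟩ := h₂
  exact ⟨l + k, by rw [iterate_add_apply]⟩

/-- Two nodes reached from the same node are comparable. -/
theorem Reaches.comparable {s : Fin (n + 1) → Fin (n + 1)} {w y z : Fin (n + 1)}
    (h₁ : Reaches s w y) (h₂ : Reaches s w z) : Reaches s y z ∨ Reaches s z y := by
  obtain ⟨k, rfl⟩ := h₁
  obtain ⟨l, rfl⟩ := h₂
  rcases le_total k l with h | h
  · exact .inl ⟨l - k, by rw [← iterate_add_apply, Nat.sub_add_cancel h]⟩
  · exact .inr ⟨k - l, by rw [← iterate_add_apply, Nat.sub_add_cancel h]⟩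

theorem Reaches.of_ne {s : Fin (n + 1) → Fin (n + 1)} {w y : Fin (n + 1)}
    (h : Reaches s w y) (hne : w ≠ y) : Reaches s (s w) y := by
  obtain ⟨k, hk⟩ := h
  cases k with
  | zero => exact absurd hk hne
  | succ k => exact ⟨k, hk⟩

/-- The only node on a directed cycle that is connected to the root is the root itself. -/
theorem Reaches.eq_root {s : Fin (n + 1) → Fin (n + 1)} {r w : Fin (n + 1)} (hr : s r = r)
    (hw : Reaches s w r) (hcycle : Reaches s (s w) w) : w = r := by
  obtain ⟨k, hk⟩ := hw
  obtain ⟨m, hm⟩ := hcycle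
  have hper : IsPeriodicPt s ((m + 1) * k) w :=
    IsPeriodicPt.mul_const (show s^[m + 1] w = w from hm) k
  have h : s^[m * k + k] w = r := by
    rw [iterate_add_apply, hk]
    exact iterate_fixed hr _
  rw [← h, ← Nat.succ_mul]
  exact hper.symm

/-- Changing the strategy of a node `u` which reaches `y` under both profiles
preserves the set of nodes that reach `y`. -/
theorem Reaches.of_eq_off {s t : Fin (n + 1) → Fin (n + 1)} {u w y : Fin (n + 1)}
    (hst : ∀ z, z ≠ u → t z = s z) (hu : Reaches t u y) (h : Reaches s w y) :
    Reaches t w y := by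
  obtain ⟨k, hk⟩ := h
  induction k generalizing w with
  | zero => exact ⟨0, hk⟩
  | succ k ih =>
    by_cases hwu : w = u
    · rwa [hwu]
    · exact Reaches.head (by rw [hst w hwu]; exact ih hk)

theorem subtreeSize_eq_ncard (s : Fin (n + 1) → Fin (n + 1)) (u : Fin (n + 1)) :
    subtreeSize s u = {w | Reaches s w u}.ncard := rfl

theorem indeg_eq_ncard (r : Fin (n + 1)) (s : Fin (n + 1) → Fin (n + 1)) (v : Fin (n + 1)) :
    indeg r s v = {u | u ≠ r ∧ s u = v}.ncard := rfl

theorem subtreeSize_pos (s : Fin (n + 1) → Fin (n + 1)) (u : Fin (n + 1)) :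
    0 < subtreeSize s u := by
  rw [subtreeSize_eq_ncard, Set.ncard_pos]
  exact ⟨u, .refl s u⟩

theorem subtreeSize_eq_of_eq_off {s t : Fin (n + 1) → Fin (n + 1)} {u y : Fin (n + 1)}
    (hst : ∀ z, z ≠ u → t z = s z) (hs : Reaches s u y) (ht : Reaches t u y) :
    subtreeSize t y = subtreeSize s y := by
  rw [subtreeSize_eq_ncard, subtreeSize_eq_ncard]
  congr 1
  ext w
  exact ⟨.of_eq_off (fun z hz => (hst z hz).symm) hs, .of_eq_off hst ht⟩

theorem cost_root (r : Fin (n + 1)) (s : Fin (n + 1) → Fin (n + 1)) : cost r s r = 0 := by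
  have h : ∃ k, s^[k] r = r := ⟨0, rfl⟩
  have h0 : Nat.find h = 0 := (Nat.find_eq_zero h).2 rfl
  rw [cost, dif_pos h, h0, Finset.sum_range_zero]

theorem cost_eq_add {r v : Fin (n + 1)} {s : Fin (n + 1) → Fin (n + 1)} (hv : v ≠ r)
    (h : Reaches s v r) :
    cost r s v = (indeg r s (s v) : ℝ≥0∞) / (subtreeSize s v : ℝ≥0∞) + cost r s (s v) := by
  have h₁ : ∃ k, s^[k] v = r := h
  have h₂ : ∃ k, s^[k] (s v) = r := h.of_ne hv
  have hfind : Nat.find h₁ = Nat.find h₂ + 1 := Nat.find_comp_succ h₁ h₂ hv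
  rw [cost, cost, dif_pos h₁, dif_pos h₂, hfind, Finset.sum_range_succ', add_comm]
  rfl

theorem cost_ne_top {r v : Fin (n + 1)} {s : Fin (n + 1) → Fin (n + 1)} (h : Reaches s v r) :
    cost r s v ≠ ⊤ := by
  have h' : ∃ k, s^[k] v = r := h
  rw [cost, dif_pos h']
  refine ENNReal.sum_ne_top.2 fun k _ => ENNReal.div_ne_top (ENNReal.natCast_ne_top _) ?_
  exact_mod_cast (subtreeSize_pos s _).ne'

/-- Two profiles which agree along a path to the root, together with the in-degrees and
subtree sizes there, give the same cost. -/
theorem cost_congr {r : Fin (n + 1)} {s t : Fin (n + 1) → Fin (n + 1)} {A : Set (Fin (n + 1))}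
    (hA : ∀ y ∈ A, s y ∈ A) (hst : ∀ y ∈ A, t y = s y)
    (hindeg : ∀ y ∈ A, y ≠ r → indeg r t (s y) = indeg r s (s y))
    (hsize : ∀ y ∈ A, subtreeSize t y = subtreeSize s y)
    {y : Fin (n + 1)} (hy : y ∈ A) (hs : Reaches s y r) (ht : Reaches t y r) :
    cost r t y = cost r s y := by
  obtain ⟨k, hk⟩ := hs
  induction k generalizing y with
  | zero =>
    obtain rfl : y = r := hk
    rw [cost_root, cost_root]
  | succ k ih =>
    by_cases hyr : y = r
    · rw [hyr, cost_root, cost_root]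
    · have ht' : Reaches t (s y) r := hst y hy ▸ ht.of_ne hyr
      rw [cost_eq_add hyr ht, cost_eq_add hyr ⟨k + 1, hk⟩, hst y hy, hindeg y hy hyr,
        hsize y hy, ih (hA y hy) ht' hk]

theorem indeg_update_of_ne {r u w z : Fin (n + 1)} {s : Fin (n + 1) → Fin (n + 1)}
    (hw : z ≠ w) (hz : z ≠ s u) : indeg r (update s u w) z = indeg r s z := by
  rw [indeg_eq_ncard, indeg_eq_ncard]
  congr 1
  ext y
  by_cases hy : y = u
  · subst hy
    simp [hw.symm, hz.symm]
  · simp [update_of_ne hy]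

theorem indeg_update_le (r u w : Fin (n + 1)) (s : Fin (n + 1) → Fin (n + 1)) :
    indeg r (update s u w) w ≤ indeg r s w + 1 := by
  rw [indeg_eq_ncard, indeg_eq_ncard]
  refine (Set.ncard_le_ncard ?_ (Set.toFinite _)).trans (Set.ncard_insert_le u _)
  rintro y ⟨hyr, hy⟩
  by_cases hyu : y = u
  · exact .inl hyu
  · exact .inr ⟨hyr, by rwa [update_of_ne hyu] at hy⟩

theorem indeg_update_self_add_one {r u w : Fin (n + 1)} {s : Fin (n + 1) → Fin (n + 1)}
    (hu : u ≠ r) (hw : w ≠ s u) : indeg r (update s u w) (s u) + 1 = indeg r s (s u) := by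
  rw [indeg_eq_ncard, indeg_eq_ncard, ← Set.ncard_insert_of_notMem (a := u) (by simp [hw])]
  congr 1
  ext y
  by_cases hy : y = u
  · subst hy
    simp [hu]
  · simp [hy]

/-- If `u` redirects her edge to an incomparable node `v`, the subtree of `v` gains that
of `u`. -/
theorem subtreeSize_add_le_update {s : Fin (n + 1) → Fin (n + 1)} {u v : Fin (n + 1)}
    (huv : ¬ Reaches s u v) (hvu : ¬ Reaches s v u) :
    subtreeSize s u + subtreeSize s v ≤ subtreeSize (update s u v) v := by
  have hst : ∀ z, z ≠ u → update s u v z = s z := fun z hz => update_of_ne hz v s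
  have huv' : Reaches (update s u v) u v := ⟨1, by simp⟩
  simp only [subtreeSize_eq_ncard]
  rw [← Set.ncard_union_eq _ (Set.toFinite _) (Set.toFinite _)]
  · refine Set.ncard_le_ncard ?_ (Set.toFinite _)
    rintro w (hw | hw)
    · exact (Reaches.of_eq_off hst (.refl _ u) hw).trans huv'
    · exact Reaches.of_eq_off hst huv' hw
  · rw [Set.disjoint_left]
    intro w hwu hwv
    exact (Reaches.comparable hwu hwv).elim huv hvu

/-- In any stable tree, if `x` has two distinct children `u` and `v`
(i.e. the activated edges `(u, x)` and `(v, x)` belong to the tree), then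
`indeg(x) ≤ indeg(v) · (1 + |T(u)|/|T(v)|) + 1`. -/
theorem sibling_degree_bound {n : ℕ} (s : Fin (n + 1) → Fin (n + 1))
    (hstable : IsStable 0 s) (htree : ∀ v, ∃ k, s^[k] v = 0)
    (x u v : Fin (n + 1)) (hu : u ≠ 0) (hv : v ≠ 0) (huv : u ≠ v)
    (hux : s u = x) (hvx : s v = x) :
    (indeg 0 s x : ℝ) ≤
      (indeg 0 s v : ℝ) * (1 + (subtreeSize s u : ℝ) / (subtreeSize s v : ℝ)) + 1 := by
  subst hux
  obtain ⟨⟨hroot, -⟩, hnash⟩ := hstable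
  have hxu : ¬ Reaches s (s u) u := fun h => hu (Reaches.eq_root hroot (htree u) h)
  have hxv : ¬ Reaches s (s u) v := fun h => hv (Reaches.eq_root hroot (htree v) (hvx ▸ h))
  have huv' : ¬ Reaches s u v := fun h => hxv (h.of_ne huv)
  have hvu' : ¬ Reaches s v u := fun h => hxu (hvx ▸ h.of_ne huv.symm)
  have hvne : v ≠ s u := fun h => hxv (h ▸ .refl s v)
  set t := update s u v with ht
  have htu : t u = v := update_self u v s
  have hst : ∀ z, z ≠ u → t z = s z := fun z hz => update_of_ne hz v s
  have htv : t v = s u := (hst v huv.symm).trans hvx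
  have hpath : ∀ y, Reaches s (s u) y → Reaches t (s u) y := by
    rintro y ⟨k, rfl⟩
    induction k with
    | zero => exact .refl t _
    | succ k ih =>
      rw [iterate_succ_apply', ← hst _ fun h => hxu ⟨k, h⟩]
      exact ih.tail
  have hpathv : ∀ y, Reaches s (s u) y → Reaches t v y := fun y hy =>
    Reaches.head (by rw [htv]; exact hpath y hy)
  have hpathu : ∀ y, Reaches s (s u) y → Reaches t u y := fun y hy =>
    Reaches.head (by rw [htu]; exact hpathv y hy)
  have hcost : cost 0 t (s u) = cost 0 s (s u) := by
    refine cost_congr (A := {y | Reaches s (s u) y}) (fun y hy => hy.tail)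
      (fun y hy => hst y fun h => hxu (h ▸ hy)) (fun y hy hy0 => ?_)
      (fun y hy => subtreeSize_eq_of_eq_off hst hy.head (hpathu y hy))
      (Reaches.refl s _) (htree _) (hpath 0 (htree _))
    refine indeg_update_of_ne (fun h => hxv (h ▸ hy.tail)) fun h => hy0 ?_
    exact Reaches.eq_root hroot (htree y) (h ▸ hy)
  have hsizeu : subtreeSize t u = subtreeSize s u :=
    subtreeSize_eq_of_eq_off hst (.refl s u) (.refl t u)
  have hle := hnash u hu v huv.symm
  rw [← ht, cost_eq_add hu (htree u), cost_eq_add hu (hpathu 0 (htree _)), htu,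
    cost_eq_add hv (hpathv 0 (htree _)), htv, hcost, hsizeu, ← add_assoc,
    ENNReal.add_le_add_iff_right (cost_ne_top (htree _))] at hle
  have ha := subtreeSize_pos s u
  have hb := subtreeSize_pos s v
  have hc := subtreeSize_pos t v
  have hsizev : subtreeSize s u + subtreeSize s v ≤ subtreeSize t v :=
    subtreeSize_add_le_update huv' hvu'
  have hindegv : indeg 0 t v ≤ indeg 0 s v + 1 := indeg_update_le 0 u v s
  have hindegx : indeg 0 t (s u) + 1 = indeg 0 s (s u) := indeg_update_self_add_one hu hvne
  have hfin : ∀ p q : ℕ, 0 < q → (p : ℝ≥0∞) / (q : ℝ≥0∞) ≠ ⊤ := fun p q hq =>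
    ENNReal.div_ne_top (ENNReal.natCast_ne_top _) (by exact_mod_cast hq.ne')
  have hreal := ENNReal.toReal_mono
    (ENNReal.add_ne_top.2 ⟨hfin _ _ ha, hfin _ _ hc⟩) hle
  rw [ENNReal.toReal_add (hfin _ _ ha) (hfin _ _ hc)] at hreal
  simp only [ENNReal.toReal_div, ENNReal.toReal_natCast] at hreal
  rw [← hindegx] at hreal ⊢
  generalize indeg 0 t (s u) = d at *
  generalize indeg 0 t v = e' at *
  generalize indeg 0 s v = e at *
  generalize subtreeSize t v = c at *
  generalize subtreeSize s u = a at *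
  generalize subtreeSize s v = b at *
  have ha' : (0 : ℝ) < a := by exact_mod_cast ha
  have hb' : (0 : ℝ) < b := by exact_mod_cast hb
  have he : (e' : ℝ) ≤ e + 1 := by exact_mod_cast hindegv
  have hab : (a : ℝ) + b ≤ c := by exact_mod_cast hsizev
  have key : ((d : ℝ) + 1) / a ≤ (e + 1) / a + d / (a + b) := by
    calc ((d : ℝ) + 1) / a ≤ e' / a + d / c := by exact_mod_cast hreal
      _ ≤ (e + 1) / a + d / (a + b) := by gcongr
  rw [div_add_div _ _ ha'.ne' (by positivity), div_le_div_iff₀ ha' (by positivity)] at key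
  have key' : (d : ℝ) * b ≤ e * (a + b) := by nlinarith
  have : (d : ℝ) ≤ e * (1 + a / b) := by
    rw [one_add_div hb'.ne', ← mul_div_assoc, le_div_iff₀ hb']
    linarith
  push_cast
  linarith

end TCG
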